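/- Let M(S) be an Artin monoid and let E ⊆ M(S) be a generating set that is closed under left complement and left least common multiple, i.e. whenever p, q ∈ E and their left least common multiple ℓ exists, then ℓ, p/q and q/p lie in E ∪ {1}, where p/q denotes the unique element with ℓ = (p/q)·q. Let a ∈ M(S) with a ≠ 1, and let b ∈ E ∪ {1}. Then there exists a unique greatest right divisor d of a for which d·b ∈ E ∪ {1}: that is, a = c·d for some c, d·b ∈ E ∪ {1}, and every v such that a = u·v for some u and v·b ∈ E ∪ {1} satisfies d = t·v for some t. -/

import Mathlib

/-- The alternating word `sts…` with `m` letters. -/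
def altWord {S : Type*} (s t : S) : ℕ → List S
  | 0 => []
  | n + 1 => s :: altWord t s n

theorem altWord_map {S T : Type*} (f : S → T) (s t : S) (k : ℕ) :
    (altWord s t k).map f = altWord (f s) (f t) k := by
  induction k generalizing s t with
  | zero => rfl
  | succ n ih => simp [altWord, ih]

/-- A Coxeter matrix on `S`, with `⊤ : ℕ∞` meaning no relation. -/
structure CoxeterMat (S : Type*) where
  m : S → S → ℕ∞
  diag : ∀ s, m s s = 1
  symm : ∀ s t, m s t = m t s
  two_le : ∀ s t, s ≠ t → 2 ≤ m s t

variable {S : Type*}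

/-- The braid relations of the Artin monoid presentation. -/
def artinRel (M : CoxeterMat S) : FreeMonoid S → FreeMonoid S → Prop := fun a b =>
  ∃ (s t : S) (k : ℕ), s ≠ t ∧ M.m s t = (k : ℕ∞) ∧
    a = FreeMonoid.ofList (altWord s t k) ∧ b = FreeMonoid.ofList (altWord t s k)

/-- The Artin monoid of a Coxeter matrix. -/
abbrev ArtinMonoid (M : CoxeterMat S) : Type _ := PresentedMonoid (artinRel M)

/-- The canonical generators of the Artin monoid. -/
abbrev ArtinMonoid.of (M : CoxeterMat S) (s : S) : ArtinMonoid M :=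
  PresentedMonoid.of (artinRel M) s

/-- Restriction of a Coxeter matrix to a subset. -/
def CoxeterMat.restrict (M : CoxeterMat S) (T : Set S) : CoxeterMat T where
  m s t := M.m s t
  diag s := M.diag s
  symm s t := M.symm s t
  two_le s t h := M.two_le s t (fun hc => h (Subtype.ext hc))

theorem presentedMonoid_mk_ofList_map {α β : Type*} {rels : FreeMonoid β → FreeMonoid β → Prop}
    (φ : α → β) (l : List α) :
    FreeMonoid.lift (fun a => PresentedMonoid.of rels (φ a)) (FreeMonoid.ofList l)
      = PresentedMonoid.mk rels (FreeMonoid.ofList (l.map φ)) := by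
  induction l with
  | nil => rfl
  | cons x l ih =>
      rw [show FreeMonoid.ofList (x :: l) = FreeMonoid.of x * FreeMonoid.ofList l from rfl,
        map_mul, ih]
      rfl

/-- The monoid homomorphism between Artin monoids induced by a map of generating sets
compatible with the Coxeter matrices. -/
def ArtinMonoid.mapOf {A B : Type*} {MA : CoxeterMat A} {MB : CoxeterMat B} (φ : A → B)
    (hm : ∀ a a', MA.m a a' = MB.m (φ a) (φ a')) :
    ArtinMonoid MA →* ArtinMonoid MB := by
  refine PresentedMonoid.lift (fun a => PresentedMonoid.of (artinRel MB) (φ a)) ?_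
  rintro a b ⟨s, t, k, hst, hk, rfl, rfl⟩
  have hne : φ s ≠ φ t := by
    intro hc
    have h1 : MB.m (φ s) (φ t) = 1 := by rw [hc, MB.diag]
    have h2 := MA.two_le s t hst
    rw [hm s t, h1] at h2
    exact absurd h2 (by decide)
  rw [presentedMonoid_mk_ofList_map, presentedMonoid_mk_ofList_map,
    altWord_map, altWord_map]
  exact Quotient.sound (ConGen.Rel.of _ _ ⟨φ s, φ t, k, hne, by rw [← hm s t]; exact hk, rfl, rfl⟩)

/-- The canonical homomorphism `M(T) → M(T')` for `T ⊆ T'`. -/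
def ArtinMonoid.incl (M : CoxeterMat S) {T T' : Set S} (h : T ⊆ T') :
    ArtinMonoid (M.restrict T) →* ArtinMonoid (M.restrict T') :=
  ArtinMonoid.mapOf (Set.inclusion h) (fun _ _ => rfl)

/-- The canonical homomorphism `M(T) → M(S)`. -/
def ArtinMonoid.ι (M : CoxeterMat S) (T : Set S) :
    ArtinMonoid (M.restrict T) →* ArtinMonoid M :=
  ArtinMonoid.mapOf Subtype.val (fun _ _ => rfl)

/-- `ℓ` is a left least common multiple of `a` and `b`. -/
def IsLeftLcm {Mo : Type*} [Monoid Mo] (a b ℓ : Mo) : Prop :=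
  (∃ u, ℓ = u * a) ∧ (∃ v, ℓ = v * b) ∧
    ∀ d : Mo, (∃ x, d = x * a) → (∃ y, d = y * b) → ∃ e, d = e * ℓ

/-- `E` is closed under left least common multiples and left complements. -/
def IsClosedUnderLcmAndCompl {Mo : Type*} [Monoid Mo] (E : Set Mo) : Prop :=
  ∀ p q ℓ : Mo, p ∈ E → q ∈ E → IsLeftLcm p q ℓ →
    ℓ ∈ E ∪ {1} ∧ (∀ c, ℓ = c * q → c ∈ E ∪ {1}) ∧ (∀ c, ℓ = c * p → c ∈ E ∪ {1})


/-! ### Alternating products -/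

/-- The alternating product `… a b a` with `n` factors, ending in `a`. -/
def alternatingProd {N : Type*} [Monoid N] (a b : N) : ℕ → N
  | 0 => 1
  | n + 1 => alternatingProd b a n * a

section alternatingProd

variable {N : Type*} [Monoid N]

/-- The factor which extends an alternating product of `n` factors on the left. -/
def alternatingNext {α : Type*} (a b : α) (n : ℕ) : α := if Even n then a else b

theorem alternatingNext_swap_succ {α : Type*} (a b : α) (n : ℕ) :
    alternatingNext b a (n + 1) = alternatingNext a b n := by
  by_cases h : Even n <;> simp [alternatingNext, h, Nat.even_add_one]

theorem alternatingProd_succ' (a b : N) (n : ℕ) :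
    alternatingProd a b (n + 1) = alternatingNext a b n * alternatingProd a b n := by
  induction n generalizing a b with
  | zero => simp [alternatingProd, alternatingNext]
  | succ n ih =>
    rw [alternatingProd, ih b a, mul_assoc, ← alternatingNext_swap_succ b a n]
    rfl

theorem alternatingProd_add (a b : N) (k n : ℕ) :
    alternatingProd a b (k + n) =
      alternatingProd (alternatingNext a b n) (alternatingNext b a n) k *
        alternatingProd a b n := by
  induction n generalizing a b with
  | zero => simp [alternatingProd, alternatingNext]
  | succ n ih =>
    rw [← add_assoc, alternatingProd, ih b a, alternatingNext_swap_succ,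
      alternatingNext_swap_succ, mul_assoc]
    rfl

theorem map_alternatingProd {N' : Type*} [Monoid N'] (f : N →* N') (a b : N) (n : ℕ) :
    f (alternatingProd a b n) = alternatingProd (f a) (f b) n := by
  induction n generalizing a b with
  | zero => simp [alternatingProd]
  | succ n ih => simp [alternatingProd, ih]

theorem alternatingProd_op (a b : N) (n : ℕ) :
    alternatingProd (MulOpposite.op a) (MulOpposite.op b) n =
      MulOpposite.op
        (alternatingProd (alternatingNext b a n) (alternatingNext a b n) n) := by
  induction n generalizing a b with
  | zero => simp [alternatingProd]
  | succ n ih =>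
    rw [alternatingProd, ih, ← MulOpposite.op_mul, alternatingProd_succ']
    congr 2
    · by_cases h : Even n <;> simp [alternatingNext, h, Nat.even_add_one]
    · rw [alternatingNext_swap_succ, alternatingNext_swap_succ]

theorem lift_altWord (f : S → N) (s t : S) (n : ℕ) :
    FreeMonoid.lift f (FreeMonoid.ofList (altWord s t n)) =
      alternatingProd (alternatingNext (f t) (f s) n) (alternatingNext (f s) (f t) n) n := by
  induction n generalizing s t with
  | zero => simp [alternatingProd, altWord]
  | succ n ih =>
    rw [altWord, FreeMonoid.ofList_cons, map_mul, ih, FreeMonoid.lift_eval_of,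
      alternatingProd_succ']
    congr 1
    · by_cases h : Even n <;> simp [alternatingNext, h, Nat.even_add_one]
    · rw [alternatingNext_swap_succ, alternatingNext_swap_succ]

/-- An equality of the two alternating products is insensitive to the order of the factors. -/
theorem alternatingProd_next_comm {a b : N} {n : ℕ}
    (h : alternatingProd a b n = alternatingProd b a n) (k : ℕ) :
    alternatingProd (alternatingNext a b k) (alternatingNext b a k) n =
      alternatingProd a b n := by
  by_cases hk : Even k <;> simp [alternatingNext, hk, h]

end alternatingProd

/-! ### Homomorphisms out of Artin monoids -/

namespace ArtinMonoid

/-- The homomorphism out of an Artin monoid defined by images of the generators satisfying the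
braid relations. -/
def lift {N : Type*} [Monoid N] (M : CoxeterMat S) (f : S → N)
    (h : ∀ s t (k : ℕ), s ≠ t → M.m s t = k →
      alternatingProd (f s) (f t) k = alternatingProd (f t) (f s) k) :
    ArtinMonoid M →* N :=
  PresentedMonoid.lift f <| by
    rintro _ _ ⟨s, t, k, hst, hk, rfl, rfl⟩
    have h' := h s t k hst hk
    rw [lift_altWord, lift_altWord, alternatingProd_next_comm h', alternatingProd_next_comm h'.symm,
      h']

variable {M : CoxeterMat S}

@[simp]
theorem lift_of {N : Type*} [Monoid N] (f : S → N)
    (h : ∀ s t (k : ℕ), s ≠ t → M.m s t = k →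
      alternatingProd (f s) (f t) k = alternatingProd (f t) (f s) k) (s : S) :
    lift M f h (of M s) = f s := rfl

theorem mk_eq_lift (w : FreeMonoid S) :
    PresentedMonoid.mk (artinRel M) w = FreeMonoid.lift (of M) w := by
  have : PresentedMonoid.mk (artinRel M) = FreeMonoid.lift (of M) :=
    FreeMonoid.hom_eq fun _ => rfl
  rw [this]

/-- The alternating product of two generators, ending in `s`. -/
abbrev alt (M : CoxeterMat S) (s t : S) (n : ℕ) : ArtinMonoid M :=
  alternatingProd (of M s) (of M t) n

theorem braid {s t : S} {k : ℕ} (hst : s ≠ t) (hk : M.m s t = k) :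
    alt M s t k = alt M t s k := by
  have h : PresentedMonoid.mk (artinRel M) (FreeMonoid.ofList (altWord s t k)) =
      PresentedMonoid.mk (artinRel M) (FreeMonoid.ofList (altWord t s k)) :=
    PresentedMonoid.mk_eq_mk_of_rel ⟨s, t, k, hst, hk, rfl, rfl⟩
  rw [mk_eq_lift, mk_eq_lift, lift_altWord, lift_altWord] at h
  by_cases hk : Even k <;> simp only [alternatingNext, hk, if_true, if_false] at h
  · exact h.symm
  · exact h

theorem alternatingNext_of (s t : S) (n : ℕ) :
    alternatingNext (of M s) (of M t) n = of M (alternatingNext s t n) := by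
  by_cases h : Even n <;> simp [alternatingNext, h]

theorem alt_succ' (s t : S) (n : ℕ) :
    alt M s t (n + 1) = of M (alternatingNext s t n) * alt M s t n := by
  rw [alt, alternatingProd_succ', alternatingNext_of]

theorem two_le_of_eq {s t : S} {k : ℕ} (hst : s ≠ t) (hk : M.m s t = k) : 2 ≤ k := by
  have := M.two_le s t hst
  rw [hk] at this
  exact_mod_cast this

theorem pos_of_eq {s t : S} {k : ℕ} (hk : M.m s t = k) : 0 < k := by
  by_cases h : s = t
  · subst h
    have := M.diag s
    rw [hk] at this
    have : k = 1 := by exact_mod_cast this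
    omega
  · have := two_le_of_eq h hk
    omega

@[elab_as_elim]
theorem induction_left {p : ArtinMonoid M → Prop} (one : p 1)
    (of_mul : ∀ s x, p x → p (of M s * x)) (x : ArtinMonoid M) : p x := by
  obtain ⟨w, rfl⟩ := PresentedMonoid.surjective_mk x
  induction w using FreeMonoid.inductionOn' with
  | one => exact one
  | of_mul s w ih => exact of_mul s _ ih

/-! ### Length -/

/-- The length of words as a homomorphism. -/
def lenHom (M : CoxeterMat S) : ArtinMonoid M →* Multiplicative ℕ :=
  lift M (fun _ => Multiplicative.ofAdd 1) fun _ _ _ _ _ => rfl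

/-- The common length of all words representing an element of an Artin monoid. -/
def len (x : ArtinMonoid M) : ℕ := (lenHom M x).toAdd

@[simp] theorem len_one : len (1 : ArtinMonoid M) = 0 := by simp [len]

@[simp] theorem len_mul (x y : ArtinMonoid M) : len (x * y) = len x + len y := by simp [len]

@[simp] theorem len_of (s : S) : len (of M s) = 1 := rfl

theorem exists_eq_of_mul (x : ArtinMonoid M) : x = 1 ∨ ∃ s x', x = of M s * x' := by
  induction x using induction_left with
  | one => exact .inl rfl
  | of_mul s x _ => exact .inr ⟨s, x, rfl⟩

theorem eq_one_of_len {x : ArtinMonoid M} (h : len x = 0) : x = 1 := by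
  obtain rfl | ⟨s, x', rfl⟩ := exists_eq_of_mul x
  · rfl
  · simp at h

/-! ### Reversal -/

/-- The reversal of words as a homomorphism to the opposite monoid. -/
def revHom (M : CoxeterMat S) : ArtinMonoid M →* (ArtinMonoid M)ᵐᵒᵖ :=
  lift M (fun s => MulOpposite.op (of M s)) fun s t k hst hk => by
    have h := braid hst hk
    rw [alternatingProd_op, alternatingProd_op, alternatingProd_next_comm h,
      alternatingProd_next_comm h.symm]
    exact congrArg MulOpposite.op h.symm

/-- The reversal of words. -/
def rev (x : ArtinMonoid M) : ArtinMonoid M := (revHom M x).unop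

@[simp] theorem rev_one : rev (1 : ArtinMonoid M) = 1 := by simp [rev]

@[simp] theorem rev_mul (x y : ArtinMonoid M) : rev (x * y) = rev y * rev x := by simp [rev]

@[simp] theorem rev_of (s : S) : rev (of M s) = of M s := rfl

@[simp] theorem rev_rev (x : ArtinMonoid M) : rev (rev x) = x := by
  induction x using induction_left with
  | one => simp
  | of_mul s x ih => simp [ih]

theorem rev_alt {s t : S} {k : ℕ} (hst : s ≠ t) (hk : M.m s t = k) :
    rev (alt M s t k) = alt M s t k := by
  have h := braid hst hk
  have : revHom M (alt M s t k) = MulOpposite.op (alt M s t k) := by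
    rw [alt, map_alternatingProd, revHom, lift_of, lift_of, alternatingProd_op,
      alternatingProd_next_comm h.symm]
    exact congrArg MulOpposite.op h.symm
  rw [rev, this, MulOpposite.unop_op]

/-! ### The action on the dual of the geometric representation -/

/-- The sequence `U 0 = 0`, `U 1 = 1`, `U (n + 2) = c * U (n + 1) - U n` of (rescaled) Chebyshev
polynomials of the second kind. -/
def chebSeq (c : ℝ) : ℕ → ℝ
  | 0 => 0
  | 1 => 1
  | n + 2 => c * chebSeq c (n + 1) - chebSeq c n

theorem chebSeq_two (n : ℕ) : chebSeq 2 n = n := by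
  induction n using Nat.twoStepInduction with
  | zero => simp [chebSeq]
  | one => simp [chebSeq]
  | more n h0 h1 => rw [chebSeq, h0, h1]; push_cast; ring

theorem chebSeq_two_mul_cos (θ : ℝ) (n : ℕ) :
    chebSeq (2 * Real.cos θ) n * Real.sin θ = Real.sin (n * θ) := by
  induction n using Nat.twoStepInduction with
  | zero => simp [chebSeq]
  | one => simp [chebSeq]
  | more n h0 h1 =>
    rw [chebSeq, sub_mul, mul_assoc, h1, h0]
    have e1 : ((n + 2 : ℕ) : ℝ) * θ = ((n + 1 : ℕ) : ℝ) * θ + θ := by push_cast; ring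
    have e2 : (n : ℝ) * θ = ((n + 1 : ℕ) : ℝ) * θ - θ := by push_cast; ring
    rw [e1, e2, Real.sin_add, Real.sin_sub]
    ring

/-- The negated entries of twice the Gram matrix of the geometric representation. -/
noncomputable def coef (M : CoxeterMat S) (s t : S) : ℝ :=
  open Classical in
  if s = t then -2 else if M.m s t = ⊤ then 2 else 2 * Real.cos (Real.pi / (M.m s t).toNat)

theorem coef_self (s : S) : coef M s s = -2 := by simp [coef]

theorem coef_comm (s t : S) : coef M s t = coef M t s := by
  by_cases h : s = t
  · rw [h]
  · simp [coef, M.symm s t, h, Ne.symm h]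

theorem coef_eq_cos {s t : S} {k : ℕ} (hst : s ≠ t) (hk : M.m s t = k) :
    coef M s t = 2 * Real.cos (Real.pi / k) := by
  simp [coef, hst, hk]

theorem sin_pi_div_pos {k : ℕ} (hk : 2 ≤ k) : 0 < Real.sin (Real.pi / k) := by
  have hk' : (2 : ℝ) ≤ k := by exact_mod_cast hk
  refine Real.sin_pos_of_pos_of_lt_pi (by positivity) ?_
  rw [div_lt_iff₀ (by positivity)]
  nlinarith [Real.pi_pos]

theorem chebSeq_coef_eq_zero {s t : S} {k : ℕ} (hst : s ≠ t) (hk : M.m s t = k) :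
    chebSeq (coef M s t) k = 0 := by
  have h2 := two_le_of_eq hst hk
  have hk0 : (k : ℝ) ≠ 0 := by positivity
  have h := chebSeq_two_mul_cos (Real.pi / k) k
  rw [mul_div_cancel₀ _ hk0, Real.sin_pi, ← coef_eq_cos hst hk] at h
  exact (mul_eq_zero.mp h).resolve_right (sin_pi_div_pos h2).ne'

theorem chebSeq_coef_pos {s t : S} {n : ℕ} (hst : s ≠ t) (hn : 0 < n)
    (h : ∀ k : ℕ, M.m s t = k → n < k) : 0 < chebSeq (coef M s t) n := by
  by_cases htop : M.m s t = ⊤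
  · rw [show coef M s t = 2 by simp [coef, hst, htop], chebSeq_two]
    exact_mod_cast hn
  · obtain ⟨k, hk⟩ := ENat.ne_top_iff_exists.mp htop
    have hnk := h k hk.symm
    have h2 := two_le_of_eq hst hk.symm
    have hk0 : (0 : ℝ) < k := by positivity
    have hc := chebSeq_two_mul_cos (Real.pi / k) n
    rw [← coef_eq_cos hst hk.symm] at hc
    have hpos : 0 < Real.sin (n * (Real.pi / k)) := by
      refine Real.sin_pos_of_pos_of_lt_pi (by positivity) ?_
      rw [mul_div_assoc', div_lt_iff₀ hk0, mul_comm]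
      gcongr
    rw [← hc] at hpos
    exact pos_of_mul_pos_left hpos (sin_pi_div_pos h2).le

/-- The action of a generator on functions; the second component records whether the function
was positive at each reflection applied so far. -/
noncomputable def actGen (M : CoxeterMat S) (s : S) : Function.End ((S → ℝ) × Prop) :=
  fun q => (fun r => q.1 r + coef M r s * q.1 s, q.2 ∧ 0 < q.1 s)

/-- The value of a function at the `j`-th reflection of an alternating product. -/
noncomputable def reflValue (M : CoxeterMat S) (s t : S) (f : S → ℝ) (j : ℕ) : ℝ :=
  chebSeq (coef M s t) (j + 1) * f s + chebSeq (coef M s t) j * f t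

theorem reflValue_actGen (s t : S) (q : (S → ℝ) × Prop) (j : ℕ) :
    reflValue M t s (actGen M s q).1 j = reflValue M s t q.1 (j + 1) := by
  simp only [reflValue, actGen, coef_self, coef_comm t s, chebSeq]
  ring

theorem alternatingProd_actGen (s t : S) (n : ℕ) (q : (S → ℝ) × Prop) :
    alternatingProd (actGen M s) (actGen M t) n q =
      (fun r => q.1 r
        + coef M r s * ∑ j ∈ Finset.range n, (if Even j then reflValue M s t q.1 j else 0)
        + coef M r t * ∑ j ∈ Finset.range n, (if Even j then 0 else reflValue M s t q.1 j),
       q.2 ∧ ∀ j < n, 0 < reflValue M s t q.1 j) := by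
  induction n generalizing s t q with
  | zero =>
    have h1 : alternatingProd (actGen M s) (actGen M t) 0 q = q := rfl
    simp [h1]
  | succ n ih =>
    have h0 : reflValue M s t q.1 0 = q.1 s := by simp [reflValue, chebSeq]
    have hmul : alternatingProd (actGen M s) (actGen M t) (n + 1) q =
        alternatingProd (actGen M t) (actGen M s) n (actGen M s q) := rfl
    rw [hmul, ih t s, Finset.sum_range_succ', Finset.sum_range_succ']
    simp only [reflValue_actGen]
    ext r
    · simp only [Nat.even_add_one, ite_not, h0, Even.zero, if_true, actGen]
      ring
    · simp only [Nat.forall_lt_succ_left, h0, actGen, and_assoc]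

theorem actGen_braid (s t : S) (k : ℕ) (hst : s ≠ t) (hk : M.m s t = k) :
    alternatingProd (actGen M s) (actGen M t) k = alternatingProd (actGen M t) (actGen M s) k := by
  have hzero := chebSeq_coef_eq_zero hst hk
  have h2 := two_le_of_eq hst hk
  have key : ∀ (s t : S) (f : S → ℝ), chebSeq (coef M s t) k = 0 →
      ∑ j ∈ Finset.range k, (if Even j then reflValue M s t f j else 0) =
        ∑ j ∈ Finset.range k, (if Even j then 0 else reflValue M t s f j) := by
    intro s t f hz
    set U := chebSeq (coef M s t) with hU
    have e1 : ∑ j ∈ Finset.range k, (if Even j then U (j + 1) else 0) =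
        ∑ j ∈ Finset.range k, (if Even j then 0 else U j) := by
      have := Finset.sum_range_succ (fun j => if Even j then 0 else U j) k
      rw [Finset.sum_range_succ'] at this
      simpa only [Nat.even_add_one, ite_not, hz, Even.zero, if_true, add_zero, ite_self] using this
    have e2 : ∑ j ∈ Finset.range k, (if Even j then U j else 0) =
        ∑ j ∈ Finset.range k, (if Even j then 0 else U (j + 1)) := by
      have := Finset.sum_range_succ (fun j => if Even j then U j else 0) k
      rw [Finset.sum_range_succ'] at this
      have h0 : U 0 = 0 := rfl
      simpa only [Nat.even_add_one, ite_not, hz, h0, add_zero, ite_self] using this.symm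
    calc _ = (∑ j ∈ Finset.range k, (if Even j then U (j + 1) else 0)) * f s +
          (∑ j ∈ Finset.range k, (if Even j then U j else 0)) * f t := by
          rw [Finset.sum_mul, Finset.sum_mul, ← Finset.sum_add_distrib]
          exact Finset.sum_congr rfl fun j _ => by split_ifs <;> simp [reflValue, hU]
      _ = _ := by
          rw [e1, e2, Finset.sum_mul, Finset.sum_mul, ← Finset.sum_add_distrib]
          refine Finset.sum_congr rfl fun j _ => ?_
          split_ifs <;> simp [reflValue, hU, coef_comm t s, add_comm]
  have pos : ∀ (s t : S) (f : S → ℝ), s ≠ t → M.m s t = k →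
      ((∀ j < k, 0 < reflValue M s t f j) ↔ 0 < f s ∧ 0 < f t) := by
    intro s t f hst hk
    have hz := chebSeq_coef_eq_zero hst hk
    have hpos : ∀ j, 0 < j → j < k → 0 < chebSeq (coef M s t) j := fun j h0 hj =>
      chebSeq_coef_pos hst h0 fun k' hk' => by
        rw [hk] at hk'
        have : k = k' := by exact_mod_cast hk'
        omega
    constructor
    · intro h
      refine ⟨by simpa [reflValue, chebSeq] using h 0 (by omega), ?_⟩
      have h' := h (k - 1) (by omega)
      rw [reflValue, Nat.sub_add_cancel (by omega), hz, zero_mul, zero_add] at h'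
      exact pos_of_mul_pos_right h' (hpos (k - 1) (by omega) (by omega)).le
    · rintro ⟨hs, ht⟩ j hj
      have hnn : ∀ i ≤ k, 0 ≤ chebSeq (coef M s t) i := by
        intro i hi
        rcases Nat.eq_zero_or_pos i with rfl | h0
        · simp [chebSeq]
        · rcases hi.lt_or_eq with h | rfl
          · exact (hpos i h0 h).le
          · exact hz.ge
      rcases Nat.eq_zero_or_pos j with rfl | h0
      · simpa [reflValue, chebSeq] using hs
      · have a1 := mul_nonneg (hnn (j + 1) hj) hs.le
        have a2 := mul_pos (hpos j h0 hj) ht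
        rw [reflValue]
        linarith
  funext q
  rw [alternatingProd_actGen, alternatingProd_actGen]
  ext r
  · simp only
    rw [key s t q.1 hzero, key t s q.1 (by rwa [coef_comm])]
    ring
  · simp only
    rw [pos s t q.1 hst hk, pos t s q.1 hst.symm (by rwa [M.symm]), and_comm (a := 0 < q.1 s)]

/-- The action of the Artin monoid on functions together with the record of positivity. -/
noncomputable def actHom (M : CoxeterMat S) : ArtinMonoid M →* Function.End ((S → ℝ) × Prop) :=
  lift M (actGen M) actGen_braid

/-- The image of the constant function `1` under an element of the Artin monoid. -/
noncomputable def val (x : ArtinMonoid M) : S → ℝ := (actHom M x (fun _ => 1, True)).1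

/-- All reflections applied along a word for the element were applied at positive values. -/
def Good (x : ArtinMonoid M) : Prop := (actHom M x (fun _ => 1, True)).2

theorem actHom_one (q : (S → ℝ) × Prop) : actHom M 1 q = q := by
  rw [map_one]; rfl

theorem val_one (s : S) : val (1 : ArtinMonoid M) s = 1 := by
  simp [val, actHom_one]

theorem good_one : Good (1 : ArtinMonoid M) := by
  simp [Good, actHom_one]

theorem actHom_mul (x y : ArtinMonoid M) (q : (S → ℝ) × Prop) :
    actHom M (x * y) q = actHom M x (actHom M y q) := by
  rw [map_mul]; rfl

theorem val_of_mul (s r : S) (x : ArtinMonoid M) :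
    val (of M s * x) r = val x r + coef M r s * val x s := by
  rw [val, actHom_mul]; rfl

theorem val_of_mul_self (s : S) (x : ArtinMonoid M) : val (of M s * x) s = -val x s := by
  rw [val_of_mul, coef_self]; ring

theorem good_of_mul (s : S) (x : ArtinMonoid M) :
    Good (of M s * x) ↔ Good x ∧ 0 < val x s := by
  rw [Good, actHom_mul]; rfl

theorem val_injective {s : S} {x y : ArtinMonoid M} (h : val (of M s * x) = val (of M s * y)) :
    val x = val y := by
  have h1 : val x s = val y s := by
    have := congrFun h s
    rw [val_of_mul_self, val_of_mul_self] at this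
    linarith
  funext r
  have := congrFun h r
  rw [val_of_mul, val_of_mul, h1] at this
  linarith

theorem val_alt_mul_next (s t : S) (n : ℕ) (x : ArtinMonoid M) :
    val (alt M s t n * x) (alternatingNext s t n) = reflValue M s t (val x) n := by
  induction n generalizing s t x with
  | zero => simp [alternatingProd, alternatingNext, reflValue, chebSeq]
  | succ n ih =>
    have : alt M s t (n + 1) * x = alt M t s n * (of M s * x) := mul_assoc _ _ _
    rw [this, alternatingNext_swap_succ t s n, ih]
    have h := reflValue_actGen (M := M) s t (actHom M x (fun _ => 1, True)) n
    rwa [show (actGen M s (actHom M x (fun _ => 1, True))).1 = val (of M s * x) by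
      rw [val, actHom_mul]; rfl] at h

/-! ### Square-free elements -/

/-- An element of an Artin monoid is simple if no word representing it contains a square of a
generator. -/
def IsSimple (x : ArtinMonoid M) : Prop := ∀ y s z, x ≠ y * (of M s * (of M s * z))

theorem IsSimple.right {x y : ArtinMonoid M} (h : IsSimple (x * y)) : IsSimple y := by
  rintro u s v rfl
  exact h (x * u) s v (by simp only [mul_assoc])

theorem IsSimple.rev {x : ArtinMonoid M} (h : IsSimple x) : IsSimple (rev x) := by
  intro u s v hx
  refine h (ArtinMonoid.rev v) s (ArtinMonoid.rev u) ?_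
  rw [← rev_rev x, hx]
  simp [mul_assoc]

theorem Good.right {x y : ArtinMonoid M} (h : Good (x * y)) : Good y := by
  induction x using induction_left with
  | one => simpa using h
  | of_mul s x ih =>
    rw [mul_assoc, good_of_mul] at h
    exact ih h.1

theorem Good.isSimple {x : ArtinMonoid M} (h : Good x) : IsSimple x := by
  rintro y s z rfl
  have h' := h.right
  rw [good_of_mul, good_of_mul, val_of_mul_self] at h'
  linarith [h'.1.2, h'.2]

theorem exists_alt_eq_of_mul {s t : S} {k : ℕ} (hst : s ≠ t) (hk : M.m s t = k) {r : S}
    (hr : r = s ∨ r = t) : ∃ z, alt M s t k = of M r * z := by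
  obtain ⟨n, rfl⟩ : ∃ n, k = n + 1 := ⟨k - 1, by have := pos_of_eq hk; omega⟩
  have h1 := alt_succ' (M := M) s t n
  have h2 := alt_succ' (M := M) t s n
  rw [← braid hst hk] at h2
  by_cases hn : Even n <;> simp only [alternatingNext, hn, if_true, if_false] at h1 h2 <;>
    rcases hr with rfl | rfl
  exacts [⟨_, h1⟩, ⟨_, h2⟩, ⟨_, h2⟩, ⟨_, h1⟩]

theorem exists_alt_eq_alt_mul {s t : S} {k n : ℕ} (hst : s ≠ t) (hk : M.m s t = k) (hkn : k ≤ n) :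
    ∃ z, alt M s t n = alt M s t k * z := by
  refine ⟨alt M s t (n - k), ?_⟩
  have h := alternatingProd_add (of M s) (of M t) k (n - k)
  rwa [alternatingProd_next_comm (braid hst hk), Nat.add_sub_cancel' hkn] at h

theorem IsSimple.exists_alt_mul {s t : S} (hst : s ≠ t) (x : ArtinMonoid M) (hx : IsSimple x) :
    ∃ s' t' k y, (s' = s ∧ t' = t ∨ s' = t ∧ t' = s) ∧ x = alt M s' t' k * y ∧
      (∀ y', y ≠ of M s * y') ∧ ∀ y', y ≠ of M t * y' := by
  induction h : len x using Nat.strong_induction_on generalizing x with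
  | _ n ih =>
    by_cases hb : (∀ y', x ≠ of M s * y') ∧ ∀ y', x ≠ of M t * y'
    · exact ⟨s, t, 0, x, .inl ⟨rfl, rfl⟩, by simp [alternatingProd], hb⟩
    · obtain ⟨r, hr, x', rfl⟩ : ∃ r, (r = s ∨ r = t) ∧ ∃ x', x = of M r * x' := by
        by_contra! hcon
        exact hb ⟨hcon s (.inl rfl), hcon t (.inr rfl)⟩
      obtain ⟨s', t', k, y, hs't', rfl, hy⟩ := ih (len x') (by simp at h; omega) x' hx.right rfl
      by_cases hk : k = 0
      · subst hk
        rcases hr with rfl | rfl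
        · exact ⟨r, t, 1, y, .inl ⟨rfl, rfl⟩, by simp [alternatingProd], hy⟩
        · exact ⟨r, s, 1, y, .inr ⟨rfl, rfl⟩, by simp [alternatingProd], hy⟩
      · obtain ⟨n, rfl⟩ := Nat.exists_eq_succ_of_ne_zero hk
        by_cases hnext : r = alternatingNext s' t' n.succ
        · exact ⟨s', t', n.succ + 1, y, hs't', by rw [alt_succ' s' t' n.succ, ← hnext, mul_assoc], hy⟩
        · exfalso
          have hrn : r = alternatingNext s' t' n := by
            by_cases hn : Even n <;>
              simp only [alternatingNext, Nat.even_add_one, hn, Nat.succ_eq_add_one, if_true,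
                if_false, not_true, not_false_iff] at hnext ⊢ <;> grind
          refine hx 1 r (alt M s' t' n * y) ?_
          rw [alt_succ', ← hrn, one_mul, mul_assoc]

theorem val_alt_mul_next_pos {s t : S} (hst : s ≠ t) {n : ℕ} (hn : ∀ k : ℕ, M.m s t = k → n < k)
    {x : ArtinMonoid M} (hs : 0 < val x s) (ht : 0 < val x t) :
    0 < val (alt M s t n * x) (alternatingNext s t n) := by
  rw [val_alt_mul_next, reflValue]
  rcases Nat.eq_zero_or_pos n with rfl | h0
  · simpa [chebSeq] using hs
  · have h1 := chebSeq_coef_pos hst h0 hn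
    have h2 : 0 ≤ chebSeq (coef M s t) (n + 1) := by
      by_cases h : ∀ k : ℕ, M.m s t = k → n + 1 < k
      · exact (chebSeq_coef_pos hst (Nat.succ_pos n) h).le
      · push Not at h
        obtain ⟨k, hk, hkn⟩ := h
        obtain rfl : k = n + 1 := le_antisymm hkn (hn k hk)
        exact (chebSeq_coef_eq_zero hst hk).ge
    have := mul_nonneg h2 hs.le
    have := mul_pos h1 ht
    linarith

theorem IsSimple.eq_of_mul_or_val_pos {x : ArtinMonoid M} (hx : IsSimple x) (s : S) :
    (∃ x', x = of M s * x') ∨ 0 < val x s := by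
  induction h : len x using Nat.strong_induction_on generalizing x s with
  | _ n ih =>
    obtain rfl | ⟨t, x₁, hx₁⟩ := exists_eq_of_mul x
    · exact .inr (by simp [val_one])
    by_cases hst : s = t
    · exact .inl ⟨x₁, hst ▸ hx₁⟩
    by_contra! hcon
    obtain ⟨s', t', k, y, hs't', rfl, hys, hyt⟩ := hx.exists_alt_mul hst
    have hk : k ≠ 0 := by
      rintro rfl
      exact hyt x₁ (by simpa [alternatingProd] using hx₁)
    have hlen : len y < n := by
      obtain ⟨m, rfl⟩ := Nat.exists_eq_succ_of_ne_zero hk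
      rw [alt_succ'] at h
      simp at h
      omega
    have hvs := (ih _ hlen hx.right s rfl).resolve_left fun ⟨y', hy'⟩ => hys y' hy'
    have hvt := (ih _ hlen hx.right t rfl).resolve_left fun ⟨y', hy'⟩ => hyt y' hy'
    have hne : s' ≠ t' := by grind
    have hs : s = s' ∨ s = t' := by rcases hs't' with ⟨rfl, rfl⟩ | ⟨rfl, rfl⟩ <;> simp
    have hlt : ∀ m : ℕ, M.m s' t' = m → k < m := by
      intro m hm
      by_contra! hmk
      obtain ⟨z, hz⟩ := exists_alt_eq_alt_mul hne hm hmk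
      obtain ⟨z', hz'⟩ := exists_alt_eq_of_mul hne hm hs
      exact hcon.1 (z' * (z * y)) (by rw [hz, hz']; simp only [mul_assoc])
    have hpos : 0 < val (alt M s' t' k * y) (alternatingNext s' t' k) := by
      apply val_alt_mul_next_pos hne hlt <;>
        rcases hs't' with ⟨rfl, rfl⟩ | ⟨rfl, rfl⟩ <;> assumption
    obtain ⟨m, rfl⟩ := Nat.exists_eq_succ_of_ne_zero hk
    have hsm : s ≠ alternatingNext s' t' m := by
      rintro hsm
      exact hcon.1 (alt M s' t' m * y) (by rw [alt_succ', hsm, mul_assoc])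
    have : s = alternatingNext s' t' m.succ := by
      by_cases hm : Even m <;>
        simp only [alternatingNext, Nat.even_add_one, hm, Nat.succ_eq_add_one, if_true,
          if_false, not_true, not_false_iff] at hsm ⊢ <;> grind
    rw [← this] at hpos
    exact absurd hpos hcon.2.not_gt

theorem IsSimple.val_pos {s : S} {x : ArtinMonoid M} (hx : IsSimple (of M s * x)) :
    0 < val x s :=
  (hx.right.eq_of_mul_or_val_pos s).resolve_left fun ⟨x', hx'⟩ => hx 1 s x' (by rw [hx', one_mul])

theorem IsSimple.good {x : ArtinMonoid M} (hx : IsSimple x) : Good x := by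
  induction x using induction_left with
  | one => exact good_one
  | of_mul s x ih => exact (good_of_mul s x).mpr ⟨ih hx.right, hx.val_pos⟩

theorem isSimple_of (s : S) : IsSimple (of M s) := by
  intro y t z h
  have := congrArg len h
  simp at this
  omega

/-- A simple element of an Artin monoid is determined by its action on the constant function `1`;
this is a form of Matsumoto's theorem. -/
theorem IsSimple.eq_of_val_eq {x y : ArtinMonoid M} (hx : IsSimple x) (hy : IsSimple y)
    (h : val x = val y) : x = y := by
  induction x using induction_left generalizing y with
  | one =>
    obtain rfl | ⟨s, y', rfl⟩ := exists_eq_of_mul y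
    · rfl
    · have := congrFun h s
      rw [val_one, val_of_mul_self] at this
      linarith [hy.val_pos]
  | of_mul s x ih =>
    obtain ⟨y', rfl⟩ | hpos := hy.eq_of_mul_or_val_pos s
    · rw [ih hx.right hy.right (val_injective h)]
    · rw [← h, val_of_mul_self] at hpos
      linarith [hx.val_pos]

theorem IsSimple.cancel_left {s : S} {x y : ArtinMonoid M} (hx : IsSimple (of M s * x))
    (h : of M s * x = of M s * y) : x = y :=
  hx.right.eq_of_val_eq (h ▸ hx).right (val_injective (by rw [h]))

theorem IsSimple.cancel_right {s : S} {x y : ArtinMonoid M} (hx : IsSimple (x * of M s))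
    (h : x * of M s = y * of M s) : x = y := by
  have hx' := hx.rev
  have h' := congrArg ArtinMonoid.rev h
  simp only [rev_mul, rev_of] at hx' h'
  simpa using congrArg ArtinMonoid.rev (hx'.cancel_left h')

theorem IsSimple.alt_mul {s t : S} {k : ℕ} (hst : s ≠ t) (hk : M.m s t = k) {x : ArtinMonoid M}
    (hs : IsSimple (of M s * x)) (ht : IsSimple (of M t * x)) : IsSimple (alt M s t k * x) := by
  apply Good.isSimple
  have key : ∀ (s' t' : S) (n : ℕ), (s' = s ∧ t' = t ∨ s' = t ∧ t' = s) → n ≤ k →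
      Good (alt M s' t' n * x) := by
    intro s' t' n h hn
    have hne : s' ≠ t' := by grind
    have hk' : M.m s' t' = k := by
      rcases h with ⟨rfl, rfl⟩ | ⟨rfl, rfl⟩
      exacts [hk, by rwa [M.symm]]
    induction n with
    | zero => simpa [alternatingProd] using hs.right.good
    | succ n ih =>
      rw [alt_succ', mul_assoc, good_of_mul]
      refine ⟨ih (by omega), val_alt_mul_next_pos hne ?_ ?_ ?_⟩
      · intro k' hk''
        rw [hk'] at hk''
        have : k = k' := by exact_mod_cast hk''
        omega
      all_goals
        rcases h with ⟨rfl, rfl⟩ | ⟨rfl, rfl⟩ <;>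
        first | exact hs.val_pos | exact ht.val_pos
  exact key s t k (.inl ⟨rfl, rfl⟩) le_rfl

theorem IsSimple.exists_alt_mul_of_eq {s t : S} (hst : s ≠ t) {x y : ArtinMonoid M}
    (hx : IsSimple (of M s * x)) (h : of M s * x = of M t * y) :
    ∃ (k : ℕ) (z : ArtinMonoid M), M.m s t = k ∧ of M s * x = alt M s t k * z := by
  obtain ⟨s', t', n, y', hs't', hy', hys, hyt⟩ := hx.exists_alt_mul hst
  have hne : s' ≠ t' := by grind
  have hneg : val (of M s * x) s < 0 ∧ val (of M s * x) t < 0 := by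
    have h1 := hx.val_pos
    have h2 := (h ▸ hx).val_pos
    constructor
    · rw [val_of_mul_self]; linarith
    · rw [h, val_of_mul_self]; linarith
  have hsimp : IsSimple y' := (hy' ▸ hx).right
  have hvs := (hsimp.eq_of_mul_or_val_pos s).resolve_left fun ⟨y', hy'⟩ => hys y' hy'
  have hvt := (hsimp.eq_of_mul_or_val_pos t).resolve_left fun ⟨y', hy'⟩ => hyt y' hy'
  by_cases hn : ∀ k : ℕ, M.m s' t' = k → n < k
  · exfalso
    have hpos : 0 < val (alt M s' t' n * y') (alternatingNext s' t' n) := by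
      apply val_alt_mul_next_pos hne hn <;>
        rcases hs't' with ⟨rfl, rfl⟩ | ⟨rfl, rfl⟩ <;> assumption
    rw [← hy'] at hpos
    by_cases hn : Even n <;> simp only [alternatingNext, hn, if_true, if_false] at hpos <;>
      rcases hs't' with ⟨rfl, rfl⟩ | ⟨rfl, rfl⟩ <;> linarith [hneg.1, hneg.2]
  · push Not at hn
    obtain ⟨k, hk, hkn⟩ := hn
    obtain ⟨z, hz⟩ := exists_alt_eq_alt_mul hne hk hkn
    rw [hz, mul_assoc] at hy'
    rcases hs't' with ⟨rfl, rfl⟩ | ⟨rfl, rfl⟩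
    · exact ⟨k, _, hk, hy'⟩
    · rw [braid hne hk] at hy'
      exact ⟨k, _, by rwa [M.symm], hy'⟩

/-! ### Greatest elements of lattice-like sets -/

theorem exists_eq_mul_of (x : ArtinMonoid M) : x = 1 ∨ ∃ x' s, x = x' * of M s := by
  obtain h | ⟨s, x', h⟩ := exists_eq_of_mul (rev x)
  · exact .inl (by rw [← rev_rev x, h, rev_one])
  · exact .inr ⟨rev x', s, by rw [← rev_rev x, h, rev_mul, rev_of]⟩

/-- A nonempty set of bounded length which is closed under right divisors and under completing
`s * u` and `t * u` to `Δ(s, t) * u` has a greatest element for right divisibility. -/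
theorem exists_greatest {D : Set (ArtinMonoid M)} {n : ℕ} (hone : 1 ∈ D)
    (hright : ∀ x y, x * y ∈ D → y ∈ D) (hlen : ∀ x ∈ D, len x ≤ n)
    (hjoin : ∀ s t u, s ≠ t → of M s * u ∈ D → of M t * u ∈ D →
      ∃ k : ℕ, M.m s t = k ∧ alt M s t k * u ∈ D) :
    ∃ g ∈ D, ∀ u ∈ D, ∃ c, g = c * u := by
  obtain ⟨g, hg, hmax⟩ : ∃ g ∈ D, ∀ u ∈ D, len u ≤ len g := by
    have hfin : (len '' D).Finite :=
      (Set.finite_Iic n).subset (by rintro _ ⟨x, hx, rfl⟩; exact hlen x hx)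
    obtain ⟨_, ⟨g, hg, rfl⟩, h⟩ := hfin.exists_maximal ⟨_, 1, hone, rfl⟩
    refine ⟨g, hg, fun u hu => ?_⟩
    by_contra! hlt
    exact absurd (h ⟨u, hu, rfl⟩ hlt.le) hlt.not_ge
  have step : ∀ (m : ℕ) (p : ArtinMonoid M), len g ≤ len p + m → (∃ c, g = c * p) →
      ∀ s, of M s * p ∈ D → ∃ c, g = c * (of M s * p) := by
    intro m
    induction m with
    | zero =>
      intro p hp _ s hs
      have := hmax _ hs
      simp at this
      omega
    | succ m ih =>
      rintro p hp ⟨c, hc⟩ s hs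
      obtain rfl | ⟨c, r, rfl⟩ := exists_eq_mul_of c
      · have := hmax _ hs
        rw [hc] at this
        simp at this
      by_cases hrs : r = s
      · exact ⟨c, by rw [hc, hrs, mul_assoc]⟩
      have hr : of M r * p ∈ D := hright c _ (by rwa [← mul_assoc, ← hc])
      obtain ⟨k, hk, hkD⟩ := hjoin r s p hrs hr hs
      have walk : ∀ j < k, ∃ c, g = c * (alt M r s (j + 1) * p) := by
        intro j hj
        induction j with
        | zero => exact ⟨c, by rw [hc]; simp [alternatingProd, mul_assoc]⟩
        | succ j ihj =>
          rw [alt_succ' r s (j + 1), mul_assoc]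
          refine ih _ ?_ (ihj (by omega)) _ ?_
          · rw [alt_succ']
            simp
            omega
          · have h := alternatingProd_add (of M r) (of M s) (k - (j + 2)) (j + 2)
            rw [Nat.sub_add_cancel (by omega)] at h
            rw [← mul_assoc (of M _), ← alt_succ']
            rw [alt, h, mul_assoc] at hkD
            exact hright _ _ hkD
      obtain ⟨l, rfl⟩ : ∃ l, k = l + 1 := ⟨k - 1, by have := pos_of_eq hk; omega⟩
      obtain ⟨c', hc'⟩ := walk l (by omega)
      rw [braid hrs hk] at hc'
      exact ⟨c' * alt M r s l, by rw [hc', alt, alternatingProd]; simp only [mul_assoc]⟩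
  refine ⟨g, hg, fun u hu => ?_⟩
  induction u using induction_left with
  | one => exact ⟨g, by simp⟩
  | of_mul s u ih => exact step (len g) u (by omega) (ih (hright _ _ hu)) s hu

/-! ### Cancellation and least common multiples -/

/-- The equation `x * s = y * t` holds because `x * s` is a left multiple of the least common
multiple of `s` and `t`. -/
def Braided (x : ArtinMonoid M) (s : S) (y : ArtinMonoid M) (t : S) : Prop :=
  s = t ∧ x = y ∨ s ≠ t ∧ ∃ (n : ℕ) (w : ArtinMonoid M), M.m s t = (n + 1 : ℕ) ∧
    x = w * alt M t s n ∧ y = w * alt M s t n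

theorem Braided.symm {x y : ArtinMonoid M} {s t : S} (h : Braided x s y t) : Braided y t x s := by
  obtain ⟨rfl, rfl⟩ | ⟨hst, n, w, hn, rfl, rfl⟩ := h
  · exact .inl ⟨rfl, rfl⟩
  · exact .inr ⟨hst.symm, n, w, by rwa [M.symm], rfl, rfl⟩

theorem Braided.mul_left (z : ArtinMonoid M) {x y : ArtinMonoid M} {s t : S}
    (h : Braided x s y t) : Braided (z * x) s (z * y) t := by
  obtain ⟨rfl, rfl⟩ | ⟨hst, n, w, hn, rfl, rfl⟩ := h
  · exact .inl ⟨rfl, rfl⟩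
  · exact .inr ⟨hst, n, z * w, hn, by rw [mul_assoc], by rw [mul_assoc]⟩

theorem IsSimple.braided {x y : ArtinMonoid M} {s t : S} (hx : IsSimple (x * of M s))
    (h : x * of M s = y * of M t) : Braided x s y t := by
  by_cases hst : s = t
  · subst hst
    exact .inl ⟨rfl, hx.cancel_right h⟩
  · have hx' := hx.rev
    have h' := congrArg ArtinMonoid.rev h
    simp only [rev_mul, rev_of] at hx' h'
    obtain ⟨k, z, hk, hz⟩ := hx'.exists_alt_mul_of_eq hst h'
    obtain ⟨n, rfl⟩ : ∃ n, k = n + 1 := ⟨k - 1, by have := pos_of_eq hk; omega⟩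
    have hz' : x * of M s = ArtinMonoid.rev z * alt M s t (n + 1) := by
      have := congrArg ArtinMonoid.rev hz
      rwa [rev_mul, rev_rev, rev_of, rev_mul, rev_alt hst hk] at this
    have hzt : y * of M t = ArtinMonoid.rev z * alt M t s (n + 1) := by
      rw [← h, hz', braid hst hk]
    refine .inr ⟨hst, n, ArtinMonoid.rev z, hk, hx.cancel_right ?_, (h ▸ hx).cancel_right ?_⟩
    · rw [hz', mul_assoc]; rfl
    · rw [hzt, mul_assoc]; rfl

/-- Equations between elements of length at most `n` ending in given generators are explained by
least common multiples. -/
def BraidedUpTo (M : CoxeterMat S) (n : ℕ) : Prop :=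
  ∀ (x y : ArtinMonoid M) (s t : S), len x < n → x * of M s = y * of M t → Braided x s y t

theorem BraidedUpTo.cancel {n : ℕ} (h : BraidedUpTo M n) {x y z : ArtinMonoid M}
    (hn : len (x * z) ≤ n) (hxy : x * z = y * z) : x = y := by
  induction z using induction_left generalizing x y with
  | one => simpa using hxy
  | of_mul s z ih =>
    have hs : x * of M s = y * of M s := by
      refine ih ?_ ?_ <;> simp only [mul_assoc]
      exacts [hn, hxy]
    obtain ⟨_, h⟩ | ⟨hss, _⟩ := h x y s s (by simp at hn; omega) hs
    · exact h
    · exact absurd rfl hss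

theorem BraidedUpTo.exists_mul_alt {n : ℕ} (h : BraidedUpTo M n) {x y u : ArtinMonoid M} {s t : S}
    (hst : s ≠ t) (hn : len (x * (of M s * u)) ≤ n) (hxy : x * (of M s * u) = y * (of M t * u)) :
    ∃ (k : ℕ) (w : ArtinMonoid M), M.m s t = k ∧ x * (of M s * u) = w * (alt M s t k * u) := by
  have hs : x * of M s = y * of M t := by
    refine h.cancel (z := u) ?_ ?_ <;> simp only [mul_assoc]
    exacts [hn, hxy]
  obtain ⟨rfl, _⟩ | ⟨_, k, w, hk, rfl, _⟩ := h x y s t (by simp at hn; omega) hs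
  · exact absurd rfl hst
  · exact ⟨k + 1, w, hk, by
      rw [show alt M s t (k + 1) = alt M t s k * of M s from rfl]; simp only [mul_assoc]⟩

theorem BraidedUpTo.trans {n : ℕ} (h : BraidedUpTo M n) {x y z : ArtinMonoid M} {s t r : S}
    (hy : len y ≤ n) (hxy : Braided x s y t) (hyz : Braided y t z r) : Braided x s z r := by
  obtain ⟨g, ⟨⟨a, ha⟩, hgs⟩, hg⟩ := exists_greatest
    (D := {u | (∃ c, y = c * u) ∧ IsSimple (u * of M t)}) (n := n)
    ⟨⟨y, by simp⟩, by simpa using isSimple_of t⟩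
    (by
      rintro u v ⟨⟨c, hc⟩, hs⟩
      exact ⟨⟨c * u, by rw [hc, mul_assoc]⟩, by rw [mul_assoc] at hs; exact hs.right⟩)
    (by
      rintro u ⟨⟨c, rfl⟩, -⟩
      simp at hy
      omega)
    (by
      rintro s r u hsr ⟨⟨c, hc⟩, hs⟩ ⟨⟨d, hd⟩, hr⟩
      obtain ⟨k, w, hk, hw⟩ := h.exists_mul_alt hsr (hc ▸ hy) (hc.symm.trans hd)
      refine ⟨k, hk, ⟨w, hc.trans hw⟩, ?_⟩
      rw [mul_assoc] at hs hr ⊢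
      exact IsSimple.alt_mul hsr hk hs hr)
  have key : ∀ {x s}, Braided x s y t → ∃ u, u * of M s = g * of M t ∧ x = a * u := by
    rintro x s (⟨rfl, rfl⟩ | ⟨hst, m, w, hm, rfl, hw⟩)
    · exact ⟨g, rfl, ha⟩
    · obtain ⟨b, rfl⟩ := hg (alt M s t m) ⟨⟨w, hw⟩, by
        have := IsSimple.alt_mul hst hm (x := 1) (by simpa using isSimple_of s)
          (by simpa using isSimple_of t)
        rw [mul_one, braid hst hm] at this
        exact this⟩
      have hwab : w = a * b :=
        h.cancel (z := alt M s t m) (hw ▸ hy) (by rw [← hw, ha, mul_assoc])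
      refine ⟨b * alt M t s m, ?_, by rw [hwab, mul_assoc]⟩
      rw [mul_assoc, mul_assoc]
      exact congrArg (b * ·) (braid hst hm)
  obtain ⟨u, hu, rfl⟩ := key hxy
  obtain ⟨v, hv, rfl⟩ := key hyz.symm
  exact (IsSimple.braided (hu ▸ hgs) (hu.trans hv.symm)).mul_left a

theorem len_mk (w : FreeMonoid S) :
    len (PresentedMonoid.mk (artinRel M) w) = w.length := by
  induction w using FreeMonoid.inductionOn' with
  | one => simp
  | of_mul s w ih =>
    rw [map_mul, len_mul, ih, FreeMonoid.length_mul]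
    rfl

theorem freeMonoid_eq_one_or (w : FreeMonoid S) :
    w = 1 ∨ ∃ w' s, w = w' * FreeMonoid.of s :=
  (List.eq_nil_or_concat w.toList).imp id fun ⟨l, s, h⟩ => ⟨FreeMonoid.ofList l, s, by
    simpa [FreeMonoid.ofList_append] using congrArg FreeMonoid.ofList h⟩

theorem eq_of_mul_of_eq {w w' : FreeMonoid S} {s s' : S}
    (h : w * FreeMonoid.of s = w' * FreeMonoid.of s') : w = w' ∧ s = s' := by
  have h' := List.append_inj' (congrArg FreeMonoid.toList h) rfl
  exact ⟨h'.1, by simpa using h'.2⟩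

theorem braided_of_rel {p q : FreeMonoid S} (h : artinRel M p q) {p' q' : FreeMonoid S} {s t : S}
    (hp : p = p' * FreeMonoid.of s) (hq : q = q' * FreeMonoid.of t) :
    Braided (PresentedMonoid.mk (artinRel M) p') s (PresentedMonoid.mk (artinRel M) q') t := by
  obtain ⟨a, b, k, hab, hk, rfl, rfl⟩ := h
  have key : ∀ (a b : S) (n : ℕ), FreeMonoid.ofList (altWord a b (n + 1)) =
      FreeMonoid.ofList (altWord a b n) * FreeMonoid.of (alternatingNext a b n) := by
    intro a b n
    induction n generalizing a b with
    | zero => rfl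
    | succ n ih =>
      rw [altWord, FreeMonoid.ofList_cons, ih, altWord, FreeMonoid.ofList_cons, mul_assoc,
        alternatingNext_swap_succ]
  obtain ⟨n, rfl⟩ : ∃ n, k = n + 1 := ⟨k - 1, by have := pos_of_eq hk; omega⟩
  rw [key] at hp hq
  obtain ⟨rfl, rfl⟩ := eq_of_mul_of_eq hp
  obtain ⟨rfl, rfl⟩ := eq_of_mul_of_eq hq
  rw [mk_eq_lift, mk_eq_lift, lift_altWord, lift_altWord]
  simp only [alternatingNext_of]
  by_cases hn : Even n <;> simp only [alternatingNext, hn, if_true, if_false]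
  · exact .inr ⟨hab, n, 1, hk, by rw [one_mul], by rw [one_mul]⟩
  · exact .inr ⟨hab.symm, n, 1, by rwa [M.symm], by rw [one_mul], by rw [one_mul]⟩

theorem braidedUpTo (n : ℕ) : BraidedUpTo M n := by
  induction n with
  | zero => intro x y s t h; omega
  | succ n ih =>
    have main : ∀ {p q : FreeMonoid S}, ConGen.Rel (artinRel M) p q → p.length ≤ n + 1 →
        ∀ p' q' s t, p = p' * FreeMonoid.of s → q = q' * FreeMonoid.of t →
          Braided (PresentedMonoid.mk (artinRel M) p') s
            (PresentedMonoid.mk (artinRel M) q') t := by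
      have hlen : ∀ {p q : FreeMonoid S}, ConGen.Rel (artinRel M) p q → p.length = q.length := by
        intro p q h
        rw [← len_mk (M := M), ← len_mk (M := M), PresentedMonoid.mk_eq_mk_iff.mpr h]
      intro p q h
      induction h with
      | of p q h => exact fun _ _ _ _ _ hp hq => braided_of_rel h hp hq
      | refl p =>
        rintro - p' q' s t rfl hq
        obtain ⟨rfl, rfl⟩ := eq_of_mul_of_eq hq
        exact .inl ⟨rfl, rfl⟩
      | symm h ihh =>
        intro hn p' q' s t hp hq
        exact (ihh (by rwa [hlen h]) q' p' t s hq hp).symm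
      | @trans p q r hpq hqr ih1 ih2 =>
        intro hn p' r' s t hp hr
        have hn' := hlen hpq
        obtain rfl | ⟨q', u, rfl⟩ := freeMonoid_eq_one_or q
        · rw [hp] at hn'
          simp [FreeMonoid.length_mul] at hn'
        · refine ih.trans (y := PresentedMonoid.mk _ q') (t := u) ?_ (ih1 hn p' q' s u hp rfl)
            (ih2 (by omega) q' r' u t rfl hr)
          rw [len_mk]
          rw [FreeMonoid.length_mul, FreeMonoid.length_of] at hn'
          omega
      | @mul w x y z hwx hyz ih1 ih2 =>
        intro hn p' q' s t hp hq
        have hl := hlen hyz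
        rw [FreeMonoid.length_mul] at hn
        obtain rfl | ⟨y', s', rfl⟩ := freeMonoid_eq_one_or y
        · obtain rfl : z = 1 := FreeMonoid.length_eq_zero.mp hl.symm
          exact ih1 (by omega) p' q' s t (by simpa using hp) (by simpa using hq)
        · obtain rfl | ⟨z', t', rfl⟩ := freeMonoid_eq_one_or z
          · simp [FreeMonoid.length_mul] at hl
          · rw [← mul_assoc] at hp hq
            obtain ⟨rfl, rfl⟩ := eq_of_mul_of_eq hp
            obtain ⟨rfl, rfl⟩ := eq_of_mul_of_eq hq
            rw [map_mul, map_mul, PresentedMonoid.mk_eq_mk_iff.mpr hwx]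
            exact (ih2 (by omega) y' z' s' t' rfl rfl).mul_left _
    intro x y s t hx h
    obtain ⟨p, rfl⟩ := PresentedMonoid.surjective_mk x
    obtain ⟨q, rfl⟩ := PresentedMonoid.surjective_mk y
    rw [len_mk] at hx
    refine main (p := p * FreeMonoid.of s) (q := q * FreeMonoid.of t)
      (PresentedMonoid.mk_eq_mk_iff.mp (by rw [map_mul, map_mul]; exact h)) ?_ p q s t rfl rfl
    rw [FreeMonoid.length_mul, FreeMonoid.length_of]
    omega

/-- Artin monoids are right cancellative. -/
theorem mul_right_cancel_of_eq {x y z : ArtinMonoid M} (h : x * z = y * z) : x = y :=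
  (braidedUpTo _).cancel le_rfl h

/-- Two elements of an Artin monoid with a common left multiple have a left least common
multiple. -/
theorem exists_isLeftLcm {a p q u v : ArtinMonoid M} (hp : a = u * p) (hq : a = v * q) :
    ∃ l, IsLeftLcm p q l := by
  obtain ⟨g, hgD, hg⟩ := exists_greatest
    (D := {x | ∀ d, (∃ c, d = c * p) → (∃ c, d = c * q) → ∃ c, d = c * x}) (n := len a)
    (fun d _ _ => ⟨d, by simp⟩)
    (fun x y hxy d h1 h2 => by
      obtain ⟨c, hc⟩ := hxy d h1 h2
      exact ⟨c * x, by rw [hc, mul_assoc]⟩)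
    (fun x hx => by
      obtain ⟨c, rfl⟩ := hx a ⟨u, hp⟩ ⟨v, hq⟩
      simp)
    (fun s t x hst hs ht => by
      have key : ∀ d, (∃ c, d = c * p) → (∃ c, d = c * q) →
          ∃ (k : ℕ) (w : ArtinMonoid M), M.m s t = k ∧ d = w * (alt M s t k * x) := by
        intro d h1 h2
        obtain ⟨c, rfl⟩ := hs d h1 h2
        obtain ⟨c', hc'⟩ := ht _ h1 h2
        exact (braidedUpTo _).exists_mul_alt hst le_rfl hc'
      obtain ⟨k, -, hk, -⟩ := key a ⟨u, hp⟩ ⟨v, hq⟩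
      refine ⟨k, hk, fun d h1 h2 => ?_⟩
      obtain ⟨k', w, hk', hw⟩ := key d h1 h2
      obtain rfl : k = k' := by
        rw [hk] at hk'
        exact_mod_cast hk'
      exact ⟨w, hw⟩)
  exact ⟨g, hg p fun d h _ => h, hg q fun d _ h => h, hgD⟩

theorem eq_of_mul_of_len_le {x y c : ArtinMonoid M} (h : x = c * y) (hl : len x ≤ len y) :
    x = y := by
  rw [h, len_mul] at hl
  rw [h, eq_one_of_len (x := c) (by omega), one_mul]

theorem isLeftLcm_mul_right {p q l : ArtinMonoid M} (h : IsLeftLcm p q l) (b : ArtinMonoid M) :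
    IsLeftLcm (p * b) (q * b) (l * b) := by
  obtain ⟨⟨u, hu⟩, ⟨v, hv⟩, hl⟩ := h
  refine ⟨⟨u, by rw [hu, mul_assoc]⟩, ⟨v, by rw [hv, mul_assoc]⟩, ?_⟩
  rintro d ⟨x, rfl⟩ ⟨y, hy⟩
  obtain ⟨e, he⟩ := hl (x * p) ⟨x, rfl⟩
    ⟨y, mul_right_cancel_of_eq (z := b) (by simpa only [mul_assoc] using hy)⟩
  exact ⟨e, by rw [← mul_assoc, he, mul_assoc]⟩

theorem isLeftLcm_mem {E : Set (ArtinMonoid M)} (hE : IsClosedUnderLcmAndCompl E)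
    {p q l : ArtinMonoid M} (hp : p ∈ E ∪ {1}) (hq : q ∈ E ∪ {1}) (h : IsLeftLcm p q l) :
    l ∈ E ∪ {1} := by
  have aux : ∀ {x}, (∃ e, x = e * l) → (∃ c, l = c * x) → x ∈ E ∪ {1} → l ∈ E ∪ {1} := by
    rintro x ⟨e, he⟩ ⟨c, hc⟩ hx
    rwa [eq_of_mul_of_len_le hc (by rw [he, len_mul]; omega)]
  rcases hp with hpE | rfl
  · rcases hq with hqE | rfl
    · exact (hE p q l hpE hqE h).1
    · exact aux (h.2.2 p ⟨1, by simp⟩ ⟨p, by simp⟩) h.1 (.inl hpE)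
  · exact aux (h.2.2 q ⟨q, by simp⟩ ⟨1, by simp⟩) h.2.1 hq

end ArtinMonoid

/-- For `a ≠ 1` in an Artin monoid and `b ∈ E ∪ {1}`, with `E` a generating
set closed under left complement and left least common multiple, there is a unique greatest
right divisor `d` of `a` such that `d·b ∈ E ∪ {1}`. -/
theorem exists_unique_greatest_right_divisor {S : Type*} (M : CoxeterMat S)
    (E : Set (ArtinMonoid M)) (hgen : Submonoid.closure E = ⊤)
    (hE : IsClosedUnderLcmAndCompl E)
    (a b : ArtinMonoid M) (ha : a ≠ 1) (hb : b ∈ E ∪ {1}) :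
    ∃! d : ArtinMonoid M, (∃ c, a = c * d) ∧ d * b ∈ E ∪ {1} ∧
      ∀ u v : ArtinMonoid M, a = u * v → v * b ∈ E ∪ {1} → ∃ t, d = t * v := by
  classical
  let P : ℕ → Prop := fun n =>
    ∃ d, (∃ c, a = c * d) ∧ d * b ∈ E ∪ {1} ∧ ArtinMonoid.len d = n
  have hex : ∃ n, P n :=
    ⟨_, 1, ⟨a, by simp⟩, by simpa using hb, rfl⟩
  have hbound : ∀ n, P n → n ≤ ArtinMonoid.len a := by
    rintro _ ⟨d, ⟨c, rfl⟩, -, rfl⟩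
    simp
  obtain ⟨m, hm⟩ := hex
  obtain ⟨d, ⟨c, hc⟩, hdE, hd⟩ := Nat.findGreatest_spec (P := P) (hbound m hm) hm
  refine ⟨d, ⟨⟨c, hc⟩, hdE, fun u v huv hv => ?_⟩, ?_⟩
  · obtain ⟨l, hl⟩ := ArtinMonoid.exists_isLeftLcm hc huv
    obtain ⟨e, he⟩ := hl.2.2 a ⟨c, hc⟩ ⟨u, huv⟩
    have hlE := ArtinMonoid.isLeftLcm_mem hE hdE hv (ArtinMonoid.isLeftLcm_mul_right hl b)
    have hle := Nat.le_findGreatest (P := P) (hbound _ ⟨l, ⟨e, he⟩, hlE, rfl⟩)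
      ⟨l, ⟨e, he⟩, hlE, rfl⟩
    rw [← hd] at hle
    obtain ⟨⟨x, hx⟩, hy, -⟩ := hl
    rwa [ArtinMonoid.eq_of_mul_of_len_le hx hle] at hy
  · rintro d' ⟨⟨c', hc'⟩, hd'E, hd'⟩
    obtain ⟨t, ht⟩ := hd' c d hc hdE
    have hle := Nat.le_findGreatest (P := P) (hbound _ ⟨d', ⟨c', hc'⟩, hd'E, rfl⟩)
      ⟨d', ⟨c', hc'⟩, hd'E, rfl⟩
    exact ArtinMonoid.eq_of_mul_of_len_le ht (hle.trans hd.ge)
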